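/- Let K be a finite set, k irreducible Markov rates with stationary ρ > 0, and suppose there exists c > 0 such that (L_s f, L f) ≥ c · (max_{x,y}|f(x)−f(y)|)² for all f : K → ℝ, where L_s = (L+L*)/2 in the ρ-weighted inner product. Then there exists t₀ > 0 such that for every initial probability distribution μ on K, the Donsker-Varadhan functional I(μ_t) along the Master equation is non-increasing for all t ≥ t₀: d/dt I(μ_t) ≤ 0. -/

import Mathlib

open Finset

/-- The backward generator `Lf(x) = ∑_y k(x,y)[f(y)-f(x)]`. -/
noncomputable def gen {K : Type*} [Fintype K] (k : K → K → ℝ) (f : K → ℝ) (x : K) : ℝ :=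
  ∑ y, k x y * (f y - f x)

/-- The ρ-adjoint generator `L*f(x) = ∑_y (ρ(y)k(y,x)/ρ(x))[f(y)-f(x)]`. -/
noncomputable def genStar {K : Type*} [Fintype K] (k : K → K → ℝ) (ρ : K → ℝ) (f : K → ℝ)
    (x : K) : ℝ :=
  ∑ y, (ρ y * k y x / ρ x) * (f y - f x)

/-- The Donsker-Varadhan occupation-time rate function
`I(ν) = sup_{g>0} ( -∑_x (ν(x)/g(x)) ∑_y k(x,y)[g(y)-g(x)] )`. -/
noncomputable def DV {K : Type*} [Fintype K] (k : K → K → ℝ) (ν : K → ℝ) : ℝ :=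
  sSup {r : ℝ | ∃ g : K → ℝ, (∀ x, 0 < g x) ∧
    r = -∑ x, (ν x / g x) * ∑ y, k x y * (g y - g x)}

/-- The functional maximised over `g > 0` in the definition of `DV`. -/
noncomputable def dvForm {K : Type*} [Fintype K] (k : K → K → ℝ) (ν g : K → ℝ) : ℝ :=
  -∑ x, (ν x / g x) * gen k g x

/-- The energy `∑_{x,y} ρ(x)k(x,y)[f(y)-f(x)][u(y)-u(x)]`. -/
noncomputable def energy {K : Type*} [Fintype K] (k : K → K → ℝ) (ρ f u : K → ℝ) : ℝ :=
  ∑ x, ∑ y, ρ x * k x y * ((f y - f x) * (u y - u x))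

/-- The total rate, shifted by one to be positive. -/
noncomputable def totalRate {K : Type*} [Fintype K] (k : K → K → ℝ) : ℝ :=
  ∑ x, ∑ y, k x y + 1

section

variable {K : Type*} [Fintype K] {k : K → K → ℝ} {ρ : K → ℝ}

theorem totalRate_pos (hk : ∀ x y, 0 ≤ k x y) : 0 < totalRate k := by
  have : 0 ≤ ∑ x, ∑ y, k x y := sum_nonneg fun x _ => sum_nonneg fun y _ => hk x y
  unfold totalRate
  linarith

theorem sum_rate_le_totalRate (hk : ∀ x y, 0 ≤ k x y) (x : K) : ∑ y, k x y ≤ totalRate k := by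
  have : ∑ y, k x y ≤ ∑ x, ∑ y, k x y :=
    single_le_sum (f := fun x => ∑ y, k x y) (fun x _ => sum_nonneg fun y _ => hk x y)
      (mem_univ x)
  unfold totalRate
  linarith

theorem abs_gen_le (hk : ∀ x y, 0 ≤ k x y) {f : K → ℝ} {d : ℝ} (hd : 0 ≤ d)
    (hf : ∀ x y, |f x - f y| ≤ d) (x : K) : |gen k f x| ≤ totalRate k * d := by
  calc |gen k f x| ≤ ∑ y, |k x y * (f y - f x)| := abs_sum_le_sum_abs _ _
    _ ≤ ∑ y, k x y * d := by
        refine sum_le_sum fun y _ => ?_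
        rw [abs_mul, abs_of_nonneg (hk x y)]
        exact mul_le_mul_of_nonneg_left (hf y x) (hk x y)
    _ = (∑ y, k x y) * d := by rw [sum_mul]
    _ ≤ totalRate k * d := mul_le_mul_of_nonneg_right (sum_rate_le_totalRate hk x) hd

theorem exists_oscillation [Nonempty K] (f : K → ℝ) :
    ∃ x₀ y₀, ∀ x y, |f x - f y| ≤ |f x₀ - f y₀| := by
  obtain ⟨p, hp⟩ := Finite.exists_max fun p : K × K => |f p.1 - f p.2|
  exact ⟨p.1, p.2, fun x y => hp (x, y)⟩

theorem sum_mul_sub (ρ : K → ℝ) (φ : K → ℝ)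
    (hstat : ∀ x, ∑ y, (ρ x * k x y - ρ y * k y x) = 0) :
    ∑ x, ∑ y, ρ x * k x y * (φ y - φ x) = 0 := by
  have h1 : ∑ x, ∑ y, ρ x * k x y * φ y = ∑ x, ∑ y, ρ y * k y x * φ x := sum_comm
  have h2 : ∑ x, ∑ y, (ρ y * k y x * φ x - ρ x * k x y * φ x) = 0 := by
    refine sum_eq_zero fun x _ => ?_
    have : ∑ y, (ρ y * k y x * φ x - ρ x * k x y * φ x)
        = -(φ x) * ∑ y, (ρ x * k x y - ρ y * k y x) := by
      rw [mul_sum]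
      exact sum_congr rfl fun y _ => by ring
    rw [this, hstat, mul_zero]
  simp only [sum_sub_distrib, mul_sub] at h2 ⊢
  linarith

theorem energy_eq (hρ : ∀ x, 0 < ρ x) (f u : K → ℝ) :
    energy k ρ f u = -2 * ∑ z, ρ z * ((gen k f z + genStar k ρ f z) / 2) * u z := by
  have h1 : ∑ x, ∑ y, ρ x * k x y * ((f y - f x) * u y)
      = ∑ x, ∑ y, ρ y * k y x * ((f x - f y) * u x) := sum_comm
  have h2 : energy k ρ f u = ∑ x, ∑ y, ρ x * k x y * ((f y - f x) * u y)
      - ∑ x, ∑ y, ρ x * k x y * ((f y - f x) * u x) := by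
    simp only [energy, ← sum_sub_distrib]
    exact sum_congr rfl fun x _ => sum_congr rfl fun y _ => by ring
  rw [h2, h1, ← sum_sub_distrib, mul_sum]
  refine sum_congr rfl fun x _ => ?_
  have hx := (hρ x).ne'
  have h3 : ρ x * genStar k ρ f x = ∑ y, ρ y * k y x * (f y - f x) := by
    rw [genStar, mul_sum]
    exact sum_congr rfl fun y _ => by field_simp
  have h4 : -2 * (ρ x * ((gen k f x + genStar k ρ f x) / 2) * u x)
      = -(ρ x * genStar k ρ f x) * u x - ρ x * gen k f x * u x := by ring
  rw [h4, h3, gen, mul_sum, sum_mul, ← sum_neg_distrib, sum_mul, ← sum_sub_distrib,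
    ← sum_sub_distrib]
  exact sum_congr rfl fun y _ => by ring

/-- The sector condition forces a spectral gap. -/
theorem sq_le_energy (hk : ∀ x y, 0 ≤ k x y) (hρ : ∀ x, 0 < ρ x) (hρ1 : ∀ x, ρ x ≤ 1)
    {c : ℝ} (hc : 0 < c) {f : K → ℝ} {d : ℝ} (hd : 0 ≤ d) (hf : ∀ x y, |f x - f y| ≤ d)
    (hsec : c * d ^ 2 ≤ ∑ z, ρ z * ((gen k f z + genStar k ρ f z) / 2) * gen k f z) :
    c ^ 2 / totalRate k ^ 3 * d ^ 2 ≤ energy k ρ f f := by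
  set B := totalRate k with hB
  have hBpos : 0 < B := totalRate_pos hk
  have hL := abs_gen_le hk hd hf
  have he := energy_eq (k := k) hρ f (gen k f)
  have key : -energy k ρ f (gen k f) ≤ c * d ^ 2 + B ^ 3 / c * energy k ρ f f := by
    have : -energy k ρ f (gen k f)
        ≤ ∑ x, ∑ y, (k x y * (c / B * d ^ 2)
          + B ^ 3 / c * (ρ x * k x y * ((f y - f x) * (f y - f x)))) := by
      rw [energy, ← sum_neg_distrib]
      refine sum_le_sum fun x _ => ?_
      rw [← sum_neg_distrib]
      refine sum_le_sum fun y _ => ?_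
      have h1 : |gen k f y - gen k f x| ≤ 2 * (B * d) := by
        have := abs_sub (gen k f y) (gen k f x)
        linarith [hL x, hL y]
      have h2 : -((f y - f x) * (gen k f y - gen k f x)) ≤ |f y - f x| * (2 * (B * d)) := by
        calc _ ≤ |(f y - f x) * (gen k f y - gen k f x)| := neg_le_abs _
          _ = |f y - f x| * |gen k f y - gen k f x| := abs_mul _ _
          _ ≤ _ := mul_le_mul_of_nonneg_left h1 (abs_nonneg _)
      have h3 : |f y - f x| * (2 * (B * d))
          ≤ c / B * d ^ 2 + B ^ 3 / c * ((f y - f x) * (f y - f x)) := by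
        have h4 : (f y - f x) * (f y - f x) = |f y - f x| ^ 2 := by rw [sq_abs]; ring
        have h5 : c / B * d ^ 2 + B ^ 3 / c * |f y - f x| ^ 2 - |f y - f x| * (2 * (B * d))
            = (c * d - B ^ 2 * |f y - f x|) ^ 2 / (c * B) := by
          field_simp
          ring
        have h6 : 0 ≤ (c * d - B ^ 2 * |f y - f x|) ^ 2 / (c * B) := by positivity
        rw [h4]
        linarith
      have hw : 0 ≤ ρ x * k x y := mul_nonneg (hρ x).le (hk x y)
      have h7 := mul_le_mul_of_nonneg_left (h2.trans h3) hw
      have h8 : ρ x * k x y * (c / B * d ^ 2) ≤ k x y * (c / B * d ^ 2) := by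
        refine mul_le_mul_of_nonneg_right ?_ (by positivity)
        exact mul_le_of_le_one_left (hk x y) (hρ1 x)
      nlinarith
    have h9 : ∑ x, ∑ y, (k x y * (c / B * d ^ 2)
          + B ^ 3 / c * (ρ x * k x y * ((f y - f x) * (f y - f x))))
        = (B - 1) * (c / B * d ^ 2) + B ^ 3 / c * energy k ρ f f := by
      simp only [sum_add_distrib, ← sum_mul, ← mul_sum, energy]
      simp [hB, totalRate]
    have h10 : (B - 1) * (c / B * d ^ 2) ≤ B * (c / B * d ^ 2) :=
      mul_le_mul_of_nonneg_right (by linarith) (by positivity)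
    have h11 : B * (c / B * d ^ 2) = c * d ^ 2 := by field_simp
    linarith
  have h12 : c * d ^ 2 ≤ B ^ 3 / c * energy k ρ f f := by linarith
  have h13 := mul_le_mul_of_nonneg_left h12 (show 0 ≤ c / B ^ 3 by positivity)
  have h14 : c / B ^ 3 * (B ^ 3 / c * energy k ρ f f) = energy k ρ f f := by field_simp
  rw [h14] at h13
  calc _ = c / B ^ 3 * (c * d ^ 2) := by ring
    _ ≤ _ := h13

theorem sub_one_sq_le {r : ℝ} (hr : 0 < r) (hr4 : r ≤ 4) :
    (r - 1) ^ 2 / 9 ≤ r - 1 - Real.log r := by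
  set s := Real.sqrt r
  have hs : 0 < s := Real.sqrt_pos.2 hr
  have hsq : s ^ 2 = r := Real.sq_sqrt hr.le
  have hs2 : s ≤ 2 := by nlinarith
  have hlog : Real.log r = 2 * Real.log s := by rw [← hsq, Real.log_pow]; norm_num
  have := Real.log_le_sub_one_of_pos hs
  have h1 : (r - 1) ^ 2 = (s - 1) ^ 2 * (s + 1) ^ 2 := by rw [← hsq]; ring
  have h2 : (s - 1) ^ 2 * (s + 1) ^ 2 ≤ (s - 1) ^ 2 * 9 :=
    mul_le_mul_of_nonneg_left (by nlinarith) (sq_nonneg _)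
  nlinarith

theorem dvForm_eq {ν g : K → ℝ} (hg : ∀ x, 0 < g x) :
    dvForm k ν g = ∑ x, ∑ y, ν x * k x y * (1 - g y / g x) := by
  rw [dvForm, ← sum_neg_distrib]
  refine sum_congr rfl fun x _ => ?_
  have hx := (hg x).ne'
  rw [gen, mul_sum, ← sum_neg_distrib]
  refine sum_congr rfl fun y _ => ?_
  field_simp
  ring

theorem dvForm_stationary_le (hk : ∀ x y, 0 ≤ k x y) (hρ : ∀ x, 0 < ρ x)
    (hstat : ∀ x, ∑ y, (ρ x * k x y - ρ y * k y x) = 0) {g : K → ℝ}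
    (hg : ∀ x, |g x - 1| ≤ 1 / 2) :
    dvForm k ρ g ≤ -(4 / 81) * energy k ρ g g := by
  have hlo : ∀ x, 1 / 2 ≤ g x := fun x => by linarith [(abs_le.1 (hg x)).1]
  have hhi : ∀ x, g x ≤ 3 / 2 := fun x => by linarith [(abs_le.1 (hg x)).2]
  have hpos : ∀ x, 0 < g x := fun x => by linarith [hlo x]
  have h0 := sum_mul_sub ρ (fun x => Real.log (g x)) hstat
  have : dvForm k ρ g + ∑ x, ∑ y, ρ x * k x y * (Real.log (g y) - Real.log (g x))
      ≤ -(4 / 81) * energy k ρ g g := by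
    rw [dvForm_eq hpos, energy, mul_sum, ← sum_add_distrib]
    refine sum_le_sum fun x _ => ?_
    rw [mul_sum, ← sum_add_distrib]
    refine sum_le_sum fun y _ => ?_
    have hw : 0 ≤ ρ x * k x y := mul_nonneg (hρ x).le (hk x y)
    have hr4 : g y / g x ≤ 4 := by
      rw [div_le_iff₀ (hpos x)]
      linarith [hlo x, hhi y]
    have h1 := sub_one_sq_le (div_pos (hpos y) (hpos x)) hr4
    rw [Real.log_div (hpos y).ne' (hpos x).ne'] at h1
    have h2 : 4 / 9 * ((g y - g x) * (g y - g x)) ≤ (g y / g x - 1) ^ 2 := by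
      have hx := (hpos x).ne'
      have : (g y / g x - 1) ^ 2 = (g y - g x) ^ 2 / g x ^ 2 := by
        field_simp
      rw [this, le_div_iff₀ (by have := hpos x; positivity)]
      have h3 : g x ^ 2 ≤ 9 / 4 := by nlinarith [hlo x, hhi x]
      nlinarith [mul_le_mul_of_nonneg_left h3 (sq_nonneg (g y - g x))]
    have h4 : (1 - g y / g x) + (Real.log (g y) - Real.log (g x))
        ≤ -(4 / 81) * ((g y - g x) * (g y - g x)) := by linarith
    have h5 := mul_le_mul_of_nonneg_left h4 hw
    linarith
  linarith

/-- A critical point of `dvForm k ν` is a global maximiser. -/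
theorem dvForm_le_of_critical (hk : ∀ x y, 0 ≤ k x y) {ν g : K → ℝ} (hν : ∀ x, 0 ≤ ν x)
    (hg : ∀ x, 0 < g x)
    (hcrit : ∀ φ : K → ℝ, ∑ x, ∑ y, ν x * k x y * (g y / g x * (φ y - φ x)) = 0)
    {g' : K → ℝ} (hg' : ∀ x, 0 < g' x) : dvForm k ν g' ≤ dvForm k ν g := by
  have h0 := hcrit fun x => Real.log (g' x / g x)
  have : dvForm k ν g' ≤ dvForm k ν g - ∑ x, ∑ y, ν x * k x y *
      (g y / g x * (Real.log (g' y / g y) - Real.log (g' x / g x))) := by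
    rw [dvForm_eq hg, dvForm_eq hg', ← sum_sub_distrib]
    refine sum_le_sum fun x _ => ?_
    rw [← sum_sub_distrib]
    refine sum_le_sum fun y _ => ?_
    rw [← mul_sub]
    refine mul_le_mul_of_nonneg_left ?_ (mul_nonneg (hν x) (hk x y))
    have hx := div_pos (hg' x) (hg x)
    have hy := div_pos (hg' y) (hg y)
    have h1 := Real.log_le_sub_one_of_pos (div_pos hy hx)
    rw [Real.log_div hy.ne' hx.ne'] at h1
    have h2 := mul_le_mul_of_nonneg_left h1 (div_pos (hg y) (hg x)).le
    have h3 : g y / g x * (g' y / g y / (g' x / g x) - 1) = g' y / g' x - g y / g x := by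
      have := (hg x).ne'
      have := (hg y).ne'
      have := (hg' x).ne'
      field_simp
    linarith
  linarith

theorem dvForm_div_const {ν g : K → ℝ} (hg : ∀ x, 0 < g x) {a : ℝ} (ha : 0 < a) :
    dvForm k ν (fun x => g x / a) = dvForm k ν g := by
  rw [dvForm_eq hg, dvForm_eq fun x => div_pos (hg x) ha]
  simp only [div_div_div_cancel_right₀ ha.ne']

theorem critical_of_isMax {ν g : K → ℝ} (hg : ∀ x, 0 < g x) {ε : ℝ}
    (hgε : ∀ x, |g x - 1| < ε)
    (hmax : ∀ g' : K → ℝ, (∀ x, 0 < g' x) → (∀ x, |g' x - 1| ≤ ε) →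
      dvForm k ν g' ≤ dvForm k ν g) (φ : K → ℝ) :
    ∑ x, ∑ y, ν x * k x y * (g y / g x * (φ y - φ x)) = 0 := by
  let G : ℝ → ℝ := fun s =>
    ∑ x, ∑ y, ν x * k x y * (1 - g y / g x * Real.exp (s * (φ y - φ x)))
  have hG : ∀ s, dvForm k ν (fun x => g x * Real.exp (s * φ x)) = G s := by
    intro s
    rw [dvForm_eq fun x => mul_pos (hg x) (Real.exp_pos _)]
    refine sum_congr rfl fun x _ => sum_congr rfl fun y _ => ?_
    rw [mul_sub s, Real.exp_sub, mul_div_mul_comm]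
  have hG0 : G 0 = dvForm k ν g := by rw [← hG]; simp
  have hloc : IsLocalMax G 0 := by
    have : ∀ᶠ s in nhds (0 : ℝ), ∀ x, |g x * Real.exp (s * φ x) - 1| < ε := by
      rw [Filter.eventually_all]
      intro x
      have hcont : Continuous fun s : ℝ => |g x * Real.exp (s * φ x) - 1| := by fun_prop
      refine hcont.continuousAt.eventually_lt continuousAt_const ?_
      simpa using hgε x
    filter_upwards [this] with s hs
    rw [hG0, ← hG]
    exact hmax _ (fun x => mul_pos (hg x) (Real.exp_pos _)) fun x => (hs x).le
  have hder : HasDerivAt G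
      (∑ x, ∑ y, ν x * k x y * (-(g y / g x * (φ y - φ x)))) 0 := by
    refine HasDerivAt.fun_sum fun x _ => HasDerivAt.fun_sum fun y _ => ?_
    have h1 := ((hasDerivAt_id (0 : ℝ)).mul_const (φ y - φ x)).exp
    have h2 := (((h1.const_mul (g y / g x)).const_sub 1).const_mul (ν x * k x y))
    exact h2.congr_deriv (by simp)
  have := hloc.hasDerivAt_eq_zero hder
  simp only [mul_neg, sum_neg_distrib] at this
  linarith

theorem sum_gen_crit_nonneg [Nonempty K] (hk : ∀ x y, 0 ≤ k x y) (hρ : ∀ x, 0 < ρ x)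
    (hρ1 : ∀ x, ρ x ≤ 1) {c : ℝ}
    (hsector : ∀ f : K → ℝ, ∀ x y : K,
      c * (f x - f y) ^ 2
        ≤ ∑ z, ρ z * ((gen k f z + genStar k ρ f z) / 2) * gen k f z)
    {ε : ℝ} (hε0 : 0 ≤ ε) (hε : ε ≤ 1 / 2) (hεc : 10 * totalRate k ^ 2 * ε ≤ c)
    {ν g : K → ℝ} (hν : ∀ x, |ν x - ρ x| ≤ ε * ρ x) (hg : ∀ x, |g x - 1| ≤ ε)
    (hcrit : ∀ φ : K → ℝ, ∑ x, ∑ y, ν x * k x y * (g y / g x * (φ y - φ x)) = 0) :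
    0 ≤ ∑ x, ν x * gen k (fun z => gen k g z / g z) x := by
  set F : K → ℝ := fun z => gen k g z / g z with hF
  set B := totalRate k with hB
  have hBpos : 0 < B := totalRate_pos hk
  have hlo : ∀ x, 1 / 2 ≤ g x := fun x => by linarith [(abs_le.1 (hg x)).1]
  have hpos : ∀ x, 0 < g x := fun x => by linarith [hlo x]
  obtain ⟨x₀, y₀, hosc⟩ := exists_oscillation g
  set d := |g x₀ - g y₀| with hd
  have hd0 : 0 ≤ d := abs_nonneg _
  have hL := abs_gen_le hk hd0 hosc
  have hinv : ∀ x a b, |a| ≤ b → |a / g x| ≤ 2 * b := fun x a b hab => by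
    rw [abs_div, abs_of_pos (hpos x), div_le_iff₀ (hpos x)]
    nlinarith [hlo x, abs_nonneg a]
  have hFb : ∀ x, |F x| ≤ 2 * (B * d) := fun x => hinv x _ _ (hL x)
  have hFL : ∀ x, |F x - gen k g x| ≤ 2 * (B * d * ε) := fun x => by
    have hx := (hpos x).ne'
    have : F x - gen k g x = gen k g x * (1 - g x) / g x := by
      simp only [hF]
      field_simp
    rw [this]
    refine hinv x _ _ ?_
    rw [abs_mul, abs_sub_comm 1]
    exact mul_le_mul (hL x) (hg x) (abs_nonneg _) (by positivity)
  have hνρ : ∀ x, |ν x / g x - ρ x| ≤ 4 * ε := fun x => by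
    have hx := (hpos x).ne'
    have h1 : ν x / g x - ρ x = ((ν x - ρ x) - ρ x * (g x - 1)) / g x := by
      field_simp
      ring
    have h2 : |(ν x - ρ x) - ρ x * (g x - 1)| ≤ 2 * ε := by
      have h3 := abs_sub (ν x - ρ x) (ρ x * (g x - 1))
      rw [abs_mul, abs_of_pos (hρ x)] at h3
      have h4 := mul_le_mul_of_nonneg_left (hg x) (hρ x).le
      nlinarith [hν x, hρ1 x]
    rw [h1]
    linarith [hinv x _ _ h2]
  have hmain : 2 * (c * d ^ 2) ≤ -energy k ρ g (gen k g) := by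
    have h1 := hsector g x₀ y₀
    rw [← sq_abs, ← hd] at h1
    rw [energy_eq hρ]
    linarith
  have hrepr : ∑ x, ν x * gen k F x
      = -∑ x, ∑ y, k x y * (ν x / g x * ((g y - g x) * (F y - F x))) := by
    have h1 := hcrit F
    have h2 : ∑ x, ν x * gen k F x = ∑ x, ν x * gen k F x
        - ∑ x, ∑ y, ν x * k x y * (g y / g x * (F y - F x)) := by rw [h1, sub_zero]
    rw [h2, ← sum_sub_distrib, ← sum_neg_distrib]
    refine sum_congr rfl fun x _ => ?_
    rw [gen, mul_sum, ← sum_sub_distrib, ← sum_neg_distrib]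
    refine sum_congr rfl fun y _ => ?_
    have hx := (hpos x).ne'
    field_simp
    ring
  have herr : ∑ x, ∑ y, k x y * (ν x / g x * ((g y - g x) * (F y - F x)))
      - energy k ρ g (gen k g) ≤ (B - 1) * (20 * B * ε * d ^ 2) := by
    have hsum : (B - 1) * (20 * B * ε * d ^ 2)
        = ∑ x, ∑ y, k x y * (20 * B * ε * d ^ 2) := by
      simp only [← sum_mul]
      simp [hB, totalRate]
    rw [hsum, energy, ← sum_sub_distrib]
    refine sum_le_sum fun x _ => ?_
    rw [← sum_sub_distrib]
    refine sum_le_sum fun y _ => ?_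
    have h1 : k x y * (ν x / g x * ((g y - g x) * (F y - F x)))
        - ρ x * k x y * ((g y - g x) * (gen k g y - gen k g x))
        = k x y * ((g y - g x) * ((ν x / g x - ρ x) * (F y - F x)
          + ρ x * ((F y - gen k g y) - (F x - gen k g x)))) := by ring
    rw [h1]
    refine mul_le_mul_of_nonneg_left ?_ (hk x y)
    have h2 : |F y - F x| ≤ 4 * (B * d) := by
      linarith [abs_sub (F y) (F x), hFb x, hFb y]
    have h3 : |(F y - gen k g y) - (F x - gen k g x)| ≤ 4 * (B * d * ε) := by
      linarith [abs_sub (F y - gen k g y) (F x - gen k g x), hFL x, hFL y]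
    have h4 : |(ν x / g x - ρ x) * (F y - F x)| ≤ 4 * ε * (4 * (B * d)) := by
      rw [abs_mul]
      exact mul_le_mul (hνρ x) h2 (abs_nonneg _) (by positivity)
    have h5 : |ρ x * ((F y - gen k g y) - (F x - gen k g x))| ≤ 1 * (4 * (B * d * ε)) := by
      rw [abs_mul, abs_of_pos (hρ x)]
      exact mul_le_mul (hρ1 x) h3 (abs_nonneg _) zero_le_one
    have h6 := (abs_add_le ((ν x / g x - ρ x) * (F y - F x))
      (ρ x * ((F y - gen k g y) - (F x - gen k g x)))).trans (add_le_add h4 h5)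
    refine (le_abs_self _).trans ?_
    rw [abs_mul]
    calc _ ≤ d * (4 * ε * (4 * (B * d)) + 1 * (4 * (B * d * ε))) :=
          mul_le_mul (hosc y x) h6 (abs_nonneg _) hd0
      _ = 20 * B * ε * d ^ 2 := by ring
  have h7 : (B - 1) * (20 * B * ε * d ^ 2) ≤ B * (20 * B * ε * d ^ 2) :=
    mul_le_mul_of_nonneg_right (by linarith) (by positivity)
  have h8 := mul_le_mul_of_nonneg_right hεc (sq_nonneg d)
  rw [hrepr]
  linarith

/-- Near the stationary state the supremum in `DV` is attained, and the maximiser is close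
to `1`. -/
theorem exists_dvForm_maximiser [Nonempty K] (hk : ∀ x y, 0 ≤ k x y) (hρ : ∀ x, 0 < ρ x)
    (hρ1 : ∀ x, ρ x ≤ 1) (hstat : ∀ x, ∑ y, (ρ x * k x y - ρ y * k y x) = 0)
    {c : ℝ} (hc : 0 < c)
    (hsector : ∀ f : K → ℝ, ∀ x y : K,
      c * (f x - f y) ^ 2
        ≤ ∑ z, ρ z * ((gen k f z + genStar k ρ f z) / 2) * gen k f z)
    {ε : ℝ} (hε0 : 0 < ε) (hε : ε ≤ 1 / 2) :
    ∃ η > 0, ∀ ν : K → ℝ, (∀ x, |ν x - ρ x| ≤ η * ρ x) → ∃ g : K → ℝ,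
      (∀ x, |g x - 1| < ε) ∧ ∀ g' : K → ℝ, (∀ x, 0 < g' x) → (∀ x, |g' x - 1| ≤ ε) →
        dvForm k ν g' ≤ dvForm k ν g := by
  set B := totalRate k with hB
  have hBpos : 0 < B := totalRate_pos hk
  set l := c ^ 2 / B ^ 3 with hl
  have hlpos : 0 < l := by positivity
  refine ⟨ε * l / (400 * B), by positivity, fun ν hν => ?_⟩
  set η := ε * l / (400 * B) with hη
  have hηpos : 0 < η := by positivity
  let S : Set (K → ℝ) := Set.pi Set.univ fun _ => Set.Icc (1 - ε) (1 + ε)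
  have hS : ∀ g : K → ℝ, g ∈ S ↔ ∀ x, |g x - 1| ≤ ε := fun g => by
    simp only [S, Set.mem_univ_pi, Set.mem_Icc, abs_le]
    exact forall_congr' fun x => by constructor <;> rintro ⟨h1, h2⟩ <;> constructor <;> linarith
  have hSc : IsCompact S := isCompact_univ_pi fun _ => isCompact_Icc
  have h1S : (fun _ => 1 : K → ℝ) ∈ S := (hS _).2 fun x => by simp [hε0.le]
  have hcont : ContinuousOn (dvForm k ν) S := by
    unfold dvForm gen
    refine (continuousOn_finsetSum _ fun x _ => ContinuousOn.mul ?_ ?_).neg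
    · refine continuousOn_const.div (continuous_apply x).continuousOn fun g hg => ?_
      have := (abs_le.1 ((hS g).1 hg x)).1
      linarith
    · fun_prop
  obtain ⟨g, hgS, hgmax⟩ := hSc.exists_isMaxOn ⟨_, h1S⟩ hcont
  have hgε := (hS g).1 hgS
  have hlo : ∀ x, 1 / 2 ≤ g x := fun x => by linarith [(abs_le.1 (hgε x)).1]
  have hpos : ∀ x, 0 < g x := fun x => by linarith [hlo x]
  have h0 : 0 ≤ dvForm k ν g := by
    have : dvForm k ν (fun _ => 1) = 0 := by simp [dvForm, gen]
    rw [← this]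
    exact hgmax h1S
  obtain ⟨x₀, y₀, hosc⟩ := exists_oscillation g
  set d := |g x₀ - g y₀| with hd
  have hd0 : 0 ≤ d := abs_nonneg _
  have hstatle := dvForm_stationary_le hk hρ hstat fun x => (hgε x).trans hε
  have hgap : l * d ^ 2 ≤ energy k ρ g g :=
    sq_le_energy hk hρ hρ1 hc hd0 hosc (by rw [hd, sq_abs]; exact hsector g x₀ y₀)
  have hpert : dvForm k ν g - dvForm k ρ g ≤ 2 * η * (B - 1) * d := by
    have hsum : 2 * η * (B - 1) * d = ∑ x, ∑ y, k x y * (2 * η * d) := by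
      simp only [← sum_mul]
      simp [hB, totalRate]
      ring
    rw [hsum, dvForm_eq hpos, dvForm_eq hpos, ← sum_sub_distrib]
    refine sum_le_sum fun x _ => ?_
    rw [← sum_sub_distrib]
    refine sum_le_sum fun y _ => ?_
    rw [← sub_mul, ← sub_mul, mul_comm (ν x - ρ x), mul_assoc]
    refine mul_le_mul_of_nonneg_left ?_ (hk x y)
    have hx := (hpos x).ne'
    have h1 : |1 - g y / g x| ≤ 2 * d := by
      have : 1 - g y / g x = (g x - g y) / g x := by field_simp
      rw [this, abs_div, abs_of_pos (hpos x), div_le_iff₀ (hpos x)]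
      nlinarith [hosc x y, hlo x]
    have h2 : |ν x - ρ x| ≤ η := (hν x).trans (mul_le_of_le_one_right hηpos.le (hρ1 x))
    refine (le_abs_self _).trans ?_
    rw [abs_mul]
    calc _ ≤ η * (2 * d) := mul_le_mul h2 h1 (abs_nonneg _) hηpos.le
      _ = _ := by ring
  have hdsmall : d < ε / 2 := by
    by_contra! hcon
    have hdpos : 0 < d := by linarith
    have h1 : 4 / 81 * (l * d ^ 2) ≤ 2 * η * (B - 1) * d := by linarith
    have h2 : 2 * η * (B - 1) * d ≤ 2 * η * B * d :=
      mul_le_mul_of_nonneg_right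
        (mul_le_mul_of_nonneg_left (by linarith) (by positivity)) hd0
    have h3 : 2 * η * B * d = ε * l * d / 200 := by
      rw [hη]
      field_simp
      ring
    have h4 : 0 < l * d := by positivity
    nlinarith [mul_le_mul_of_nonneg_left hcon h4.le, mul_pos h4 hε0]
  refine ⟨fun x => g x / g x₀, fun x => ?_, fun g' _ hg' => ?_⟩
  · have hx := (hpos x₀).ne'
    have : g x / g x₀ - 1 = (g x - g x₀) / g x₀ := by field_simp
    rw [this, abs_div, abs_of_pos (hpos x₀), div_lt_iff₀ (hpos x₀)]
    nlinarith [hosc x x₀, hlo x₀]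
  · rw [dvForm_div_const hpos (hpos x₀)]
    exact hgmax ((hS g').2 hg')

theorem DV_eq_of_isMax {ν g : K → ℝ} (hg : ∀ x, 0 < g x)
    (hmax : ∀ g' : K → ℝ, (∀ x, 0 < g' x) → dvForm k ν g' ≤ dvForm k ν g) :
    DV k ν = dvForm k ν g := by
  refine IsGreatest.csSup_eq ⟨⟨g, hg, rfl⟩, ?_⟩
  rintro r ⟨g', hg', rfl⟩
  exact hmax g' hg'

theorem sum_master_mul (m φ : K → ℝ) :
    ∑ x, (∑ y, (k y x * m y - k x y * m x)) * φ x = ∑ x, m x * gen k φ x := by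
  have h1 : ∑ x, ∑ y, k y x * m y * φ x = ∑ x, ∑ y, k x y * m x * φ y := sum_comm
  have h2 : ∑ x, (∑ y, (k y x * m y - k x y * m x)) * φ x
      = ∑ x, ∑ y, k y x * m y * φ x - ∑ x, ∑ y, k x y * m x * φ x := by
    simp only [sum_mul, ← sum_sub_distrib, sub_mul]
  rw [h2, h1, ← sum_sub_distrib]
  refine sum_congr rfl fun x _ => ?_
  rw [gen, mul_sum, ← sum_sub_distrib]
  exact sum_congr rfl fun y _ => by ring

theorem antitoneOn_of_sub_le_sq {φ : ℝ → ℝ} {a C : ℝ}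
    (h : ∀ t s, a ≤ t → t ≤ s → φ s - φ t ≤ C * (s - t) ^ 2) :
    AntitoneOn φ (Set.Ici a) := by
  intro t ht s _ hts
  have hn : ∀ n : ℕ, φ s - φ t ≤ C * (s - t) ^ 2 / (n + 1) := by
    intro n
    have hpos : (0 : ℝ) < n + 1 := by positivity
    have hδ : 0 ≤ (s - t) / (n + 1) := div_nonneg (by linarith) hpos.le
    have hstep : ∀ j : ℕ, φ (t + j * ((s - t) / (n + 1))) - φ t
        ≤ j * (C * ((s - t) / (n + 1)) ^ 2) := by
      intro j
      induction j with
      | zero => simp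
      | succ j ih =>
        have ht' : a ≤ t := ht
        have h0 : 0 ≤ (j : ℝ) * ((s - t) / (n + 1)) := by positivity
        have h1 := h (t + j * ((s - t) / (n + 1))) (t + (j + 1 : ℕ) * ((s - t) / (n + 1)))
          (by linarith) (by push_cast; linarith)
        have h2 : t + (j + 1 : ℕ) * ((s - t) / (n + 1)) - (t + j * ((s - t) / (n + 1)))
            = (s - t) / (n + 1) := by push_cast; ring
        rw [h2] at h1
        push_cast at h1 ⊢
        linarith
    have h3 := hstep (n + 1)
    have h4 : t + ((n + 1 : ℕ) : ℝ) * ((s - t) / (n + 1)) = s := by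
      push_cast
      field_simp
      ring
    have h5 : ((n + 1 : ℕ) : ℝ) * (C * ((s - t) / (n + 1)) ^ 2)
        = C * (s - t) ^ 2 / (n + 1) := by
      push_cast
      field_simp
    rwa [h4, h5] at h3
  have hlim : Filter.Tendsto (fun n : ℕ => C * (s - t) ^ 2 / ((n : ℝ) + 1)) Filter.atTop
      (nhds 0) := by
    have := (tendsto_one_div_add_atTop_nhds_zero_nat (𝕜 := ℝ)).const_mul (C * (s - t) ^ 2)
    simpa [mul_one_div, div_eq_mul_inv] using this
  have := ge_of_tendsto' hlim hn
  simpa using this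

/-- A function with bounded increase of its derivative, whose derivative at the right end point
is nonpositive, increases at most quadratically. -/
theorem sub_le_sq_of_deriv {ψ ψ' ψ'' : ℝ → ℝ} {t s C : ℝ} (hts : t ≤ s)
    (h1 : ∀ r, HasDerivAt ψ (ψ' r) r) (h2 : ∀ r, HasDerivAt ψ' (ψ'' r) r)
    (hC : ∀ r, t ≤ r → |ψ'' r| ≤ C) (h0 : ψ' s ≤ 0) : ψ s - ψ t ≤ C * (s - t) ^ 2 := by
  rcases hts.eq_or_lt with rfl | hlt
  · simp
  obtain ⟨r, hr, hrs⟩ := exists_hasDerivAt_eq_slope ψ ψ' hlt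
    (fun x _ => (h1 x).continuousAt.continuousWithinAt) fun x _ => h1 x
  obtain ⟨q, hq, hqs⟩ := exists_hasDerivAt_eq_slope ψ' ψ'' hr.2
    (fun x _ => (h2 x).continuousAt.continuousWithinAt) fun x _ => h2 x
  rw [eq_div_iff (by linarith)] at hrs
  rw [eq_div_iff (by linarith [hr.2])] at hqs
  have hCq := abs_le.1 (hC q (hr.1.trans hq.1).le)
  have hC0 : 0 ≤ C := (abs_nonneg _).trans (hC t le_rfl)
  have h3 : ψ' r ≤ C * (s - t) := by nlinarith [hr.1, hr.2]
  rw [← hrs, sq, ← mul_assoc]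
  exact mul_le_mul_of_nonneg_right h3 (by linarith)

theorem sum_mul_gen_self (hstat : ∀ x, ∑ y, (ρ x * k x y - ρ y * k y x) = 0) (h : K → ℝ) :
    2 * ∑ x, ρ x * h x * gen k h x = -energy k ρ h h := by
  have h1 := sum_mul_sub ρ (fun x => h x ^ 2) hstat
  have h2 : 2 * ∑ x, ρ x * h x * gen k h x = ∑ x, ∑ y, ρ x * k x y * (h y ^ 2 - h x ^ 2)
      - energy k ρ h h := by
    rw [energy, mul_sum, ← sum_sub_distrib]
    refine sum_congr rfl fun x _ => ?_
    rw [gen, mul_sum, mul_sum, ← sum_sub_distrib]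
    exact sum_congr rfl fun y _ => by ring
  linarith

theorem sum_eq_one_of_master {μ : ℝ → K → ℝ} (h0 : ∑ x, μ 0 x = 1)
    (hμ : ∀ t x, HasDerivAt (fun s => μ s x) (∑ y, (k y x * μ t y - k x y * μ t x)) t) (t : ℝ) :
    ∑ x, μ t x = 1 := by
  have hder : ∀ t, HasDerivAt (fun s => ∑ x, μ s x) 0 t := fun t => by
    refine (HasDerivAt.fun_sum fun x _ => hμ t x).congr_deriv ?_
    have := sum_master_mul (k := k) (μ t) fun _ => 1
    simpa [gen] using this
  rw [← h0]
  exact is_const_of_deriv_eq_zero (fun t => (hder t).differentiableAt)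
    (fun t => (hder t).deriv) t 0

theorem chiSq_le [Nonempty K] (hk : ∀ x y, 0 ≤ k x y) (hρ : ∀ x, 0 < ρ x)
    (hρsum : ∑ x, ρ x = 1) (hρ1 : ∀ x, ρ x ≤ 1)
    (hstat : ∀ x, ∑ y, (ρ x * k x y - ρ y * k y x) = 0) {c : ℝ} (hc : 0 < c)
    (hsector : ∀ f : K → ℝ, ∀ x y : K,
      c * (f x - f y) ^ 2
        ≤ ∑ z, ρ z * ((gen k f z + genStar k ρ f z) / 2) * gen k f z)
    {μ : ℝ → K → ℝ} (h0 : ∑ x, μ 0 x = 1)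
    (hμ : ∀ t x, HasDerivAt (fun s => μ s x) (∑ y, (k y x * μ t y - k x y * μ t x)) t)
    {t : ℝ} (ht : 0 ≤ t) :
    ∑ x, (μ t x - ρ x) ^ 2 / ρ x
      ≤ (∑ x, (μ 0 x - ρ x) ^ 2 / ρ x) * Real.exp (-(c ^ 2 / totalRate k ^ 3) * t) := by
  set l := c ^ 2 / totalRate k ^ 3 with hl
  let h : ℝ → K → ℝ := fun s x => (μ s x - ρ x) / ρ x
  have hρh : ∀ s x, ρ x * h s x = μ s x - ρ x := fun s x => by
    have hx := (hρ x).ne'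
    simp only [h]
    field_simp
  have hder : ∀ s, HasDerivAt (fun s => ∑ x, (μ s x - ρ x) ^ 2 / ρ x)
      (-energy k ρ (h s) (h s)) s := fun s => by
    refine (HasDerivAt.fun_sum fun x _ =>
      (((hμ s x).sub_const (ρ x)).pow 2).div_const (ρ x)).congr_deriv ?_
    rw [← sum_mul_gen_self hstat]
    have h1 : ∑ x, ρ x * gen k (h s) x = 0 := by
      rw [← sum_mul_sub ρ (h s) hstat]
      refine sum_congr rfl fun x _ => ?_
      rw [gen, mul_sum]
      exact sum_congr rfl fun y _ => by ring
    have h2 : ∑ x, ρ x * h s x * gen k (h s) x = ∑ x, μ s x * gen k (h s) x := by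
      simp only [hρh, sub_mul, sum_sub_distrib, h1, sub_zero]
    rw [h2, ← sum_master_mul, mul_sum]
    refine sum_congr rfl fun x _ => ?_
    simp only [h]
    ring
  have hgap : ∀ s, l * ∑ x, (μ s x - ρ x) ^ 2 / ρ x ≤ energy k ρ (h s) (h s) := fun s => by
    obtain ⟨x₀, y₀, hosc⟩ := exists_oscillation (h s)
    set d := |h s x₀ - h s y₀| with hd
    have hd0 : 0 ≤ d := abs_nonneg _
    have hE : l * d ^ 2 ≤ energy k ρ (h s) (h s) :=
      sq_le_energy hk hρ hρ1 hc hd0 hosc (by rw [hd, sq_abs]; exact hsector (h s) x₀ y₀)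
    have hmean : ∑ y, ρ y * h s y = 0 := by
      simp only [hρh, sum_sub_distrib, sum_eq_one_of_master h0 hμ, hρsum, sub_self]
    have hhd : ∀ x, |h s x| ≤ d := fun x => by
      have : h s x = ∑ y, ρ y * (h s x - h s y) := by
        simp only [mul_sub, sum_sub_distrib, ← sum_mul, hmean, hρsum]
        ring
      rw [this]
      refine (abs_sum_le_sum_abs _ _).trans ?_
      calc _ ≤ ∑ y, ρ y * d := sum_le_sum fun y _ => by
            rw [abs_mul, abs_of_pos (hρ y)]
            exact mul_le_mul_of_nonneg_left (hosc x y) (hρ y).le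
        _ = d := by rw [← sum_mul, hρsum, one_mul]
    have hle : ∑ x, (μ s x - ρ x) ^ 2 / ρ x ≤ d ^ 2 := by
      calc _ ≤ ∑ x, ρ x * d ^ 2 := sum_le_sum fun x _ => by
            have hx := (hρ x).ne'
            have : (μ s x - ρ x) ^ 2 / ρ x = ρ x * |h s x| ^ 2 := by
              rw [sq_abs]
              simp only [h]
              field_simp
            rw [this]
            exact mul_le_mul_of_nonneg_left (pow_le_pow_left₀ (abs_nonneg _) (hhd x) 2) (hρ x).le
        _ = d ^ 2 := by rw [← sum_mul, hρsum, one_mul]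
    have hl0 : 0 ≤ l := by
      have := totalRate_pos hk
      positivity
    exact (mul_le_mul_of_nonneg_left hle hl0).trans hE
  have hanti : Antitone fun s => (∑ x, (μ s x - ρ x) ^ 2 / ρ x) * Real.exp (l * s) := by
    have hd : ∀ s, HasDerivAt (fun s => (∑ x, (μ s x - ρ x) ^ 2 / ρ x) * Real.exp (l * s))
        (-energy k ρ (h s) (h s) * Real.exp (l * s)
          + (∑ x, (μ s x - ρ x) ^ 2 / ρ x) * (Real.exp (l * s) * (l * 1))) s := fun s =>
      (hder s).mul ((hasDerivAt_id s).const_mul l).exp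
    refine antitone_of_deriv_nonpos (fun s => (hd s).differentiableAt) fun s => ?_
    rw [(hd s).deriv]
    nlinarith [mul_le_mul_of_nonneg_right (hgap s) (Real.exp_pos (l * s)).le]
  have h1 := hanti ht
  simp only [mul_zero, Real.exp_zero, mul_one] at h1
  rw [neg_mul, Real.exp_neg, ← div_eq_mul_inv, le_div_iff₀ (Real.exp_pos _)]
  exact h1

theorem exists_time_close [Nonempty K] (hk : ∀ x y, 0 ≤ k x y) (hρ : ∀ x, 0 < ρ x)
    (hρsum : ∑ x, ρ x = 1) (hρ1 : ∀ x, ρ x ≤ 1)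
    (hstat : ∀ x, ∑ y, (ρ x * k x y - ρ y * k y x) = 0) {c : ℝ} (hc : 0 < c)
    (hsector : ∀ f : K → ℝ, ∀ x y : K,
      c * (f x - f y) ^ 2
        ≤ ∑ z, ρ z * ((gen k f z + genStar k ρ f z) / 2) * gen k f z)
    {η : ℝ} (hη : 0 < η) :
    ∃ t₀ > (0 : ℝ), ∀ μ : ℝ → K → ℝ, (∀ x, 0 ≤ μ 0 x) → (∑ x, μ 0 x = 1) →
      (∀ t x, HasDerivAt (fun s => μ s x) (∑ y, (k y x * μ t y - k x y * μ t x)) t) →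
      ∀ t, t₀ ≤ t → ∀ x, |μ t x - ρ x| ≤ η * ρ x := by
  set l := c ^ 2 / totalRate k ^ 3 with hl
  have hlpos : 0 < l := by
    have := totalRate_pos hk
    positivity
  have hlim : Filter.Tendsto (fun t : ℝ => (∑ x, 1 / ρ x) * Real.exp (-l * t)) Filter.atTop
      (nhds 0) := by
    have h1 : Filter.Tendsto (fun t : ℝ => -l * t) Filter.atTop Filter.atBot :=
      Filter.tendsto_id.const_mul_atTop_of_neg (by linarith)
    simpa using (Real.tendsto_exp_atBot.comp h1).const_mul (∑ x, 1 / ρ x)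
  have hev : ∀ᶠ t in Filter.atTop, ∀ x, (∑ x, 1 / ρ x) * Real.exp (-l * t) < η ^ 2 * ρ x := by
    rw [Filter.eventually_all]
    intro x
    have := hρ x
    exact hlim.eventually_lt_const (by positivity)
  obtain ⟨T, hT⟩ := Filter.eventually_atTop.1 hev
  refine ⟨max T 1, lt_max_of_lt_right one_pos, fun μ hμ0 hμ1 hμ t ht x => ?_⟩
  have ht0 : 0 ≤ t := zero_le_one.trans ((le_max_right _ _).trans ht)
  have h1 := chiSq_le hk hρ hρsum hρ1 hstat hc hsector hμ1 hμ ht0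
  have h2 : ∑ x, (μ 0 x - ρ x) ^ 2 / ρ x ≤ ∑ x, 1 / ρ x := by
    refine sum_le_sum fun x _ => ?_
    have h3 : μ 0 x ≤ 1 := by
      rw [← hμ1]
      exact single_le_sum (fun y _ => hμ0 y) (mem_univ x)
    have h4 : |μ 0 x - ρ x| ≤ 1 := abs_le.2
      ⟨by linarith [hμ0 x, hρ1 x], by linarith [hρ x]⟩
    exact div_le_div_of_nonneg_right ((sq_le_one_iff_abs_le_one _).2 h4) (hρ x).le
  have h5 : (μ t x - ρ x) ^ 2 / ρ x ≤ ∑ x, (μ t x - ρ x) ^ 2 / ρ x :=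
    single_le_sum (f := fun x => (μ t x - ρ x) ^ 2 / ρ x)
      (fun y _ => div_nonneg (sq_nonneg _) (hρ y).le) (mem_univ x)
  have h6 := mul_le_mul_of_nonneg_right h2 (Real.exp_pos (-l * t)).le
  have h7 := hT t ((le_max_left _ _).trans ht) x
  have h8 : (μ t x - ρ x) ^ 2 / ρ x ≤ η ^ 2 * ρ x := by linarith
  rw [div_le_iff₀ (hρ x)] at h8
  refine abs_le_of_sq_le_sq ?_ (mul_nonneg hη.le (hρ x).le)
  linarith

theorem hasDerivAt_sum_mul {μ : ℝ → K → ℝ}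
    (hμ : ∀ t x, HasDerivAt (fun s => μ s x) (∑ y, (k y x * μ t y - k x y * μ t x)) t)
    (φ : K → ℝ) (t : ℝ) :
    HasDerivAt (fun s => ∑ x, μ s x * φ x) (∑ x, μ t x * gen k φ x) t := by
  rw [← sum_master_mul]
  exact HasDerivAt.fun_sum fun x _ => (hμ t x).mul_const (φ x)

theorem abs_gen_le_of_abs_le (hk : ∀ x y, 0 ≤ k x y) {f : K → ℝ} {b : ℝ} (hb : 0 ≤ b)
    (hf : ∀ x, |f x| ≤ b) (x : K) : |gen k f x| ≤ 2 * totalRate k * b := by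
  have := abs_gen_le hk (f := f) (d := 2 * b) (by linarith)
    (fun x y => by linarith [abs_sub (f x) (f y), hf x, hf y]) x
  linarith

end

theorem DV_eventually_monotone {K : Type*} [Fintype K] [Nonempty K]
    (k : K → K → ℝ) (hk : ∀ x y, 0 ≤ k x y)
    (hirr : ∀ x y : K, x ≠ y → Relation.TransGen (fun a b => 0 < k a b) x y)
    (ρ : K → ℝ) (hρpos : ∀ x, 0 < ρ x) (hρsum : ∑ x, ρ x = 1)
    (hstat : ∀ x, ∑ y, (ρ x * k x y - ρ y * k y x) = 0)
    (c : ℝ) (hc : 0 < c)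
    (hsector : ∀ f : K → ℝ, ∀ x y : K,
      c * (f x - f y) ^ 2
        ≤ ∑ z, ρ z * ((gen k f z + genStar k ρ f z) / 2) * gen k f z) :
    ∃ t₀ > (0 : ℝ), ∀ μ : ℝ → K → ℝ,
      (∀ x, 0 ≤ μ 0 x) → (∑ x, μ 0 x = 1) →
      (∀ t x, HasDerivAt (fun s => μ s x)
        (∑ y, (k y x * μ t y - k x y * μ t x)) t) →
      AntitoneOn (fun t => DV k (μ t)) (Set.Ici t₀) := by
  have hρ1 : ∀ x, ρ x ≤ 1 := fun x => by
    rw [← hρsum]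
    exact single_le_sum (fun y _ => (hρpos y).le) (mem_univ x)
  set B := totalRate k with hB
  have hBpos : 0 < B := totalRate_pos hk
  set ε := min (1 / 2) (c / (10 * B ^ 2)) with hε
  have hε0 : 0 < ε := lt_min (by norm_num) (by positivity)
  have hε2 : ε ≤ 1 / 2 := min_le_left _ _
  have hεc : 10 * B ^ 2 * ε ≤ c := by
    have := min_le_right (1 / 2) (c / (10 * B ^ 2))
    rw [← hε, le_div_iff₀ (by positivity)] at this
    linarith
  obtain ⟨η, hη0, hη⟩ := exists_dvForm_maximiser hk hρpos hρ1 hstat hc hsector hε0 hε2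
  obtain ⟨t₀, ht₀, hclose⟩ := exists_time_close hk hρpos hρsum hρ1 hstat hc hsector
    (lt_min hη0 hε0)
  refine ⟨t₀, ht₀, fun μ hμ0 hμ1 hμ => ?_⟩
  have hcl := hclose μ hμ0 hμ1 hμ
  have hclη : ∀ t, t₀ ≤ t → ∀ x, |μ t x - ρ x| ≤ η * ρ x := fun t ht x =>
    (hcl t ht x).trans (mul_le_mul_of_nonneg_right (min_le_left _ _) (hρpos x).le)
  have hclε : ∀ t, t₀ ≤ t → ∀ x, |μ t x - ρ x| ≤ ε * ρ x := fun t ht x =>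
    (hcl t ht x).trans (mul_le_mul_of_nonneg_right (min_le_right _ _) (hρpos x).le)
  have hnonneg : ∀ t, t₀ ≤ t → ∀ x, 0 ≤ μ t x := fun t ht x => by
    nlinarith [(abs_le.1 (hclε t ht x)).1, hρpos x]
  have hmax : ∀ t, t₀ ≤ t → ∃ g : K → ℝ, (∀ x, |g x - 1| ≤ ε) ∧ (∀ x, 1 / 2 ≤ g x) ∧
      (∀ φ : K → ℝ, ∑ x, ∑ y, μ t x * k x y * (g y / g x * (φ y - φ x)) = 0) ∧
      ∀ g' : K → ℝ, (∀ x, 0 < g' x) → dvForm k (μ t) g' ≤ dvForm k (μ t) g := by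
    intro t ht
    obtain ⟨g, hg, hgmax⟩ := hη (μ t) (hclη t ht)
    have hlo : ∀ x, 1 / 2 ≤ g x := fun x => by linarith [(abs_lt.1 (hg x)).1]
    have hpos : ∀ x, 0 < g x := fun x => by linarith [hlo x]
    have hcrit := critical_of_isMax hpos hg hgmax
    exact ⟨g, fun x => (hg x).le, hlo, hcrit,
      fun g' hg' => dvForm_le_of_critical hk (hnonneg t ht) hpos hcrit hg'⟩
  refine antitoneOn_of_sub_le_sq (C := 2 * B * (2 * B * (2 * B))) fun t s ht hts => ?_
  obtain ⟨g, hgε, hlo, hcrit, hgmax⟩ := hmax s (ht.trans hts)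
  obtain ⟨g₁, -, hlo₁, -, hgmax₁⟩ := hmax t ht
  have hpos : ∀ x, 0 < g x := fun x => by linarith [hlo x]
  rw [DV_eq_of_isMax hpos hgmax,
    DV_eq_of_isMax (fun x => by linarith [hlo₁ x]) hgmax₁]
  refine (sub_le_sub_left (hgmax₁ g hpos) _).trans ?_
  set F : K → ℝ := fun z => gen k g z / g z with hF
  have hform : ∀ ν, dvForm k ν g = -∑ x, ν x * F x := fun ν => by
    simp only [dvForm, hF, div_mul_eq_mul_div, mul_div_assoc]
  have hFb : ∀ x, |F x| ≤ 2 * B := fun x => by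
    have h1 := abs_gen_le hk (f := g) zero_le_one
      (fun x y => abs_le.2 ⟨by linarith [(abs_le.1 (hgε x)).1, (abs_le.1 (hgε y)).2],
        by linarith [(abs_le.1 (hgε x)).2, (abs_le.1 (hgε y)).1]⟩) x
    simp only [hF]
    rw [abs_div, abs_of_pos (hpos x), div_le_iff₀ (hpos x)]
    nlinarith [hlo x]
  have hLLF := abs_gen_le_of_abs_le hk (by positivity)
    (abs_gen_le_of_abs_le hk (by positivity) hFb)
  rw [hform, hform]
  refine sub_le_sq_of_deriv hts (fun r => (hasDerivAt_sum_mul hμ F r).neg)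
    (fun r => (hasDerivAt_sum_mul hμ (gen k F) r).neg) (fun r hr => ?_) ?_
  · rw [abs_neg]
    refine (abs_sum_le_sum_abs _ _).trans ?_
    calc _ ≤ ∑ x, μ r x * (2 * B * (2 * B * (2 * B))) := sum_le_sum fun x _ => by
          have h0 := hnonneg r (ht.trans hr) x
          rw [abs_mul, abs_of_nonneg h0]
          exact mul_le_mul_of_nonneg_left (hLLF x) h0
      _ = _ := by rw [← sum_mul, sum_eq_one_of_master hμ1 hμ, one_mul]
  · have := sum_gen_crit_nonneg hk hρpos hρ1 hsector hε0.le hε2 hεc (hclε s (ht.trans hts))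
      hgε hcrit
    simpa only [Left.neg_nonpos_iff] using this
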